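/- arXiv:2507.06857 — 2 statements merged into one kernel-verified Lean document; each statement's English description precedes it below -/
import Mathlib

section
/- Let (G_t)_{t>0} be a family of jointly measurable kernels G_t : ℝ × ℝ → [0, ∞) satisfying the Chapman–Kolmogorov property ∫_ℝ G_{t₁}(y, z)·G_{t₂}(z, η) dz = G_{t₁+t₂}(y, η) for all t₁, t₂ > 0 and y, η ∈ ℝ, and the sub-Markov property ∫_ℝ G_t(y, η) dη ≤ 1 for all t > 0 and y ∈ ℝ. Let T > 0, L ≥ 0, and let a, b : [0, T] × ℝ → [0, ∞) be bounded measurable functions such that a(t, y) ≤ b(t, y) + L·∫₀ᵗ ∫_ℝ G_{t−s}(y, η)·a(s, η) dη ds for all 0 ≤ t ≤ T and y ∈ ℝ. Then a(t, y) ≤ b(t, y) + L·e^{Lt}·∫₀ᵗ ∫_ℝ G_{t−s}(y, η)·b(s, η) dη ds for all 0 ≤ t ≤ T and y ∈ ℝ. -/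
open MeasureTheory

/-- Tonelli's theorem on the triangle `0 < r ≤ s ≤ t`. -/
theorem lintegral_triangle_swap {F : ℝ → ℝ → ENNReal} (hF : Measurable (Function.uncurry F))
    (t : ℝ) :
    ∫⁻ s in Set.Ioc (0 : ℝ) t, ∫⁻ r in Set.Ioc (0 : ℝ) s, F s r =
      ∫⁻ r in Set.Ioc (0 : ℝ) t, ∫⁻ s in Set.Icc r t, F s r := by
  have hS : MeasurableSet {p : ℝ × ℝ | 0 < p.2 ∧ p.2 ≤ p.1 ∧ p.1 ≤ t} :=
    (measurableSet_lt measurable_const measurable_snd).inter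
      ((measurableSet_le measurable_snd measurable_fst).inter
        (measurableSet_le measurable_fst measurable_const))
  have hswap := lintegral_lintegral_swap (μ := volume) (ν := volume)
    (f := fun s r => Set.indicator {p : ℝ × ℝ | 0 < p.2 ∧ p.2 ≤ p.1 ∧ p.1 ≤ t}
      (Function.uncurry F) (s, r)) (hF.indicator hS).aemeasurable
  convert hswap using 1
  · rw [← lintegral_indicator measurableSet_Ioc]
    refine lintegral_congr fun s => ?_
    by_cases hs : s ∈ Set.Ioc (0 : ℝ) t
    · rw [Set.indicator_of_mem hs, ← lintegral_indicator measurableSet_Ioc]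
      refine lintegral_congr fun r => ?_
      simp [Set.indicator_apply, hs.2]
    · rw [Set.indicator_of_notMem hs]
      symm
      rw [lintegral_eq_zero_of_ae_eq_zero]
      refine Filter.Eventually.of_forall fun r => Set.indicator_of_notMem ?_ _
      rintro ⟨h1, h2, h3⟩
      exact hs ⟨h1.trans_le h2, h3⟩
  · rw [← lintegral_indicator measurableSet_Ioc]
    refine lintegral_congr fun r => ?_
    by_cases hr : r ∈ Set.Ioc (0 : ℝ) t
    · rw [Set.indicator_of_mem hr, ← lintegral_indicator measurableSet_Icc]
      refine lintegral_congr fun s => ?_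
      simp [Set.indicator_apply, hr.1]
    · rw [Set.indicator_of_notMem hr]
      symm
      rw [lintegral_eq_zero_of_ae_eq_zero]
      refine Filter.Eventually.of_forall fun s => Set.indicator_of_notMem ?_ _
      rintro ⟨h1, h2, h3⟩
      exact hr ⟨h1, h2.trans h3⟩

theorem lintegral_Icc_mul_exp_neg_mul {L : ℝ} (hL : 0 ≤ L) {r t : ℝ} (hrt : r ≤ t) :
    ∫⁻ s in Set.Icc r t, ENNReal.ofReal (L * Real.exp (-(L * s))) =
      ENNReal.ofReal (Real.exp (-(L * r)) - Real.exp (-(L * t))) := by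
  have hcont : Continuous fun s : ℝ => L * Real.exp (-(L * s)) := by fun_prop
  rw [← ofReal_integral_eq_lintegral_ofReal (hcont.continuousOn.integrableOn_Icc)
    (Filter.Eventually.of_forall fun s => by positivity), integral_Icc_eq_integral_Ioc,
    ← intervalIntegral.integral_of_le hrt]
  congr 1
  have hderiv : ∀ s ∈ Set.uIcc r t,
      HasDerivAt (fun s : ℝ => -Real.exp (-(L * s))) (L * Real.exp (-(L * s))) s := by
    intro s _
    have h : HasDerivAt (fun s : ℝ => -Real.exp (-(L * s)))
        (-(Real.exp (-(L * s)) * -(L * 1))) s :=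
      (((hasDerivAt_id s).const_mul L).neg.exp).neg
    rwa [show -(Real.exp (-(L * s)) * -(L * 1)) = L * Real.exp (-(L * s)) by ring] at h
  rw [intervalIntegral.integral_eq_sub_of_hasDerivAt hderiv (hcont.intervalIntegrable _ _)]
  ring

/-- Gronwall's inequality in integrated form, for `ENNReal`-valued measurable functions. -/
theorem lintegral_le_exp_mul_of_le_add_mul_lintegral {L t : ℝ} (hL : 0 ≤ L)
    {m β : ℝ → ENNReal} (hm : Measurable m) (hβ : Measurable β)
    (hfin : ∫⁻ s in Set.Ioc (0 : ℝ) t, m s ≠ ⊤)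
    (h : ∀ s ∈ Set.Ioo (0 : ℝ) t,
      m s ≤ β s + ENNReal.ofReal L * ∫⁻ r in Set.Ioc (0 : ℝ) s, m r) :
    ∫⁻ s in Set.Ioc (0 : ℝ) t, m s ≤
      ENNReal.ofReal (Real.exp (L * t)) * ∫⁻ s in Set.Ioc (0 : ℝ) t, β s := by
  set e : ℝ → ENNReal := fun s => ENNReal.ofReal (Real.exp (-(L * s))) with he
  have hem : Measurable e := by fun_prop
  have he1 : ∀ s ∈ Set.Ioc (0 : ℝ) t, e s ≤ 1 := fun s hs =>
    ENNReal.ofReal_le_one.2 (Real.exp_le_one_iff.2 (by nlinarith [hs.1]))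
  set d : ℝ → ENNReal := fun r =>
    ENNReal.ofReal (Real.exp (-(L * r)) - Real.exp (-(L * t))) with hd
  have hdm : Measurable d := by fun_prop
  have hsplit : ∀ r ∈ Set.Ioc (0 : ℝ) t, e r = d r + e t := by
    intro r hr
    have hle : Real.exp (-(L * t)) ≤ Real.exp (-(L * r)) :=
      Real.exp_le_exp.2 (by nlinarith [hr.2])
    rw [he, hd, ← ENNReal.ofReal_add (by linarith) (by positivity)]
    simp
  have hswap : ∫⁻ s in Set.Ioc (0 : ℝ) t,
      ENNReal.ofReal (L * Real.exp (-(L * s))) * ∫⁻ r in Set.Ioc (0 : ℝ) s, m r =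
        ∫⁻ r in Set.Ioc (0 : ℝ) t, d r * m r := by
    calc
      _ = ∫⁻ s in Set.Ioc (0 : ℝ) t, ∫⁻ r in Set.Ioc (0 : ℝ) s,
          ENNReal.ofReal (L * Real.exp (-(L * s))) * m r := by
        simp_rw [lintegral_const_mul _ hm]
      _ = ∫⁻ r in Set.Ioc (0 : ℝ) t, ∫⁻ s in Set.Icc r t,
          ENNReal.ofReal (L * Real.exp (-(L * s))) * m r :=
        lintegral_triangle_swap
          (F := fun s r => ENNReal.ofReal (L * Real.exp (-(L * s))) * m r) (by
            unfold Function.uncurry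
            fun_prop) t
      _ = _ := by
        refine setLIntegral_congr_fun measurableSet_Ioc fun r hr => ?_
        rw [lintegral_mul_const _ (by fun_prop), lintegral_Icc_mul_exp_neg_mul hL hr.2]
  have hweighted : ∫⁻ s in Set.Ioc (0 : ℝ) t, e s * m s ≤
      (∫⁻ s in Set.Ioc (0 : ℝ) t, β s) + ∫⁻ r in Set.Ioc (0 : ℝ) t, d r * m r := by
    rw [← hswap, ← restrict_Ioo_eq_restrict_Ioc]
    refine (setLIntegral_mono' measurableSet_Ioo fun s hs => ?_).trans_eq
      (lintegral_add_left hβ _)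
    calc
      e s * m s ≤ e s * (β s + ENNReal.ofReal L * ∫⁻ r in Set.Ioc (0 : ℝ) s, m r) := by
        gcongr
        exact h s hs
      _ = e s * β s +
          ENNReal.ofReal (L * Real.exp (-(L * s))) * ∫⁻ r in Set.Ioc (0 : ℝ) s, m r := by
        rw [ENNReal.ofReal_mul hL, he]
        ring
      _ ≤ _ := by
        gcongr
        exact mul_le_of_le_one_left' (he1 s ⟨hs.1, hs.2.le⟩)
  have hdecomp : ∫⁻ s in Set.Ioc (0 : ℝ) t, e s * m s =
      e t * (∫⁻ s in Set.Ioc (0 : ℝ) t, m s) + ∫⁻ r in Set.Ioc (0 : ℝ) t, d r * m r := by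
    rw [← lintegral_const_mul _ hm, ← lintegral_add_left (by fun_prop)]
    refine setLIntegral_congr_fun measurableSet_Ioc fun s hs => ?_
    rw [hsplit s hs]
    ring
  have hdfin : ∫⁻ r in Set.Ioc (0 : ℝ) t, d r * m r ≠ ⊤ := by
    refine ne_top_of_le_ne_top hfin (setLIntegral_mono' measurableSet_Ioc fun r hr => ?_)
    refine mul_le_of_le_one_left' (le_trans ?_ (he1 r hr))
    rw [hsplit r hr]
    exact le_self_add
  rw [hdecomp] at hweighted
  have hcancel := (ENNReal.add_le_add_iff_right hdfin).1 hweighted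
  calc
    ∫⁻ s in Set.Ioc (0 : ℝ) t, m s =
        ENNReal.ofReal (Real.exp (L * t)) * (e t * ∫⁻ s in Set.Ioc (0 : ℝ) t, m s) := by
      rw [← mul_assoc, he, ← ENNReal.ofReal_mul (by positivity), ← Real.exp_add]
      simp
    _ ≤ _ := by gcongr

/-- Composing two kernel averages over a past time interval with Chapman–Kolmogorov. -/
theorem lintegral_kernel_mul_lintegral_kernel {g : ℝ → ℝ → ℝ → ENNReal}
    (hg : Measurable fun p : ℝ × ℝ × ℝ => g p.1 p.2.1 p.2.2)
    (hCK : ∀ t₁ t₂ : ℝ, 0 < t₁ → 0 < t₂ → ∀ y η : ℝ,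
      ∫⁻ z : ℝ, g t₁ y z * g t₂ z η = g (t₁ + t₂) y η)
    {f : ℝ → ℝ → ENNReal} (hf : Measurable (Function.uncurry f))
    {s t : ℝ} (hst : s < t) (y : ℝ) :
    ∫⁻ η : ℝ, g (t - s) y η *
        ∫⁻ r in Set.Ioc (0 : ℝ) s, ∫⁻ ζ : ℝ, g (s - r) η ζ * f r ζ =
      ∫⁻ r in Set.Ioc (0 : ℝ) s, ∫⁻ ζ : ℝ, g (t - r) y ζ * f r ζ := by
  have hg' : ∀ {α : Type} [MeasurableSpace α] {u v w : α → ℝ}, Measurable u → Measurable v →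
      Measurable w → Measurable fun x => g (u x) (v x) (w x) := fun hu hv hw =>
    hg.comp (hu.prodMk (hv.prodMk hw))
  have hf' : ∀ {α : Type} [MeasurableSpace α] {u v : α → ℝ}, Measurable u → Measurable v →
      Measurable fun x => f (u x) (v x) := fun hu hv => hf.comp (hu.prodMk hv)
  have hinner : Measurable fun p : (ℝ × ℝ) × ℝ => g (s - p.1.2) p.1.1 p.2 * f p.1.2 p.2 :=
    (hg' (by fun_prop) (by fun_prop) (by fun_prop)).mul (hf' (by fun_prop) (by fun_prop))
  have hmid : Measurable fun p : ℝ × ℝ => ∫⁻ ζ : ℝ, g (s - p.2) p.1 ζ * f p.2 ζ :=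
    hinner.lintegral_prod_right'
  calc
    _ = ∫⁻ η : ℝ, ∫⁻ r in Set.Ioc (0 : ℝ) s, g (t - s) y η *
        ∫⁻ ζ : ℝ, g (s - r) η ζ * f r ζ := by
      refine lintegral_congr fun η => ?_
      exact (lintegral_const_mul _ (hmid.comp (measurable_const.prodMk measurable_id))).symm
    _ = ∫⁻ r in Set.Ioc (0 : ℝ) s, ∫⁻ η : ℝ, g (t - s) y η *
        ∫⁻ ζ : ℝ, g (s - r) η ζ * f r ζ :=
      lintegral_lintegral_swap ((hg' measurable_const measurable_const measurable_fst).mul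
        hmid).aemeasurable
    _ = _ := by
      rw [← restrict_Ioo_eq_restrict_Ioc]
      refine setLIntegral_congr_fun measurableSet_Ioo fun r hr => ?_
      calc
        _ = ∫⁻ η : ℝ, ∫⁻ ζ : ℝ, g (t - s) y η * (g (s - r) η ζ * f r ζ) := by
          refine lintegral_congr fun η => ?_
          exact (lintegral_const_mul _ ((hg' measurable_const measurable_const
            measurable_id).mul (hf' measurable_const measurable_id))).symm
        _ = ∫⁻ ζ : ℝ, ∫⁻ η : ℝ, g (t - s) y η * (g (s - r) η ζ * f r ζ) :=
          lintegral_lintegral_swap ((hg' measurable_const measurable_const measurable_fst).mul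
            ((hg' measurable_const measurable_fst measurable_snd).mul
              (hf' measurable_const measurable_snd))).aemeasurable
        _ = _ := by
          refine lintegral_congr fun ζ => ?_
          simp_rw [← mul_assoc]
          rw [lintegral_mul_const (f := fun η => g (t - s) y η * g (s - r) η ζ) _
            ((hg' measurable_const measurable_const measurable_id).mul
              (hg' measurable_const measurable_id measurable_const)),
            hCK _ _ (sub_pos.2 hst) (sub_pos.2 hr.2), sub_add_sub_cancel]

/-- **Gronwall-type inequality for convolutions with a sub-Markov Chapman–Kolmogorov kernel**
(Step 1 of the proof of Lemma B.10 of the paper): if `(G_t)_{t>0}` is a family of jointly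
measurable nonnegative kernels satisfying Chapman–Kolmogorov and `∫ G_t(y, η) dη ≤ 1`, and
bounded measurable nonnegative `a, b` satisfy
`a(t,y) ≤ b(t,y) + L ∫₀ᵗ (G_{t−s} ⋆ a(s,·))(y) ds` on `[0,T] × ℝ`, then
`a(t,y) ≤ b(t,y) + L e^{Lt} ∫₀ᵗ (G_{t−s} ⋆ b(s,·))(y) ds` on `[0,T] × ℝ`. -/
theorem kernel_gronwall_inequality
    (G : ℝ → ℝ → ℝ → ℝ)
    (hGnn : ∀ t y η : ℝ, 0 ≤ G t y η)
    (hGmeas : Measurable fun p : ℝ × ℝ × ℝ => G p.1 p.2.1 p.2.2)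
    (hCK : ∀ t₁ t₂ : ℝ, 0 < t₁ → 0 < t₂ → ∀ y η : ℝ,
      (∫⁻ z : ℝ, ENNReal.ofReal (G t₁ y z) * ENNReal.ofReal (G t₂ z η)) =
        ENNReal.ofReal (G (t₁ + t₂) y η))
    (hsubMarkov : ∀ t : ℝ, 0 < t → ∀ y : ℝ, (∫⁻ η : ℝ, ENNReal.ofReal (G t y η)) ≤ 1)
    (T L : ℝ) (hT : 0 < T) (hL : 0 ≤ L)
    (a b : ℝ → ℝ → ℝ)
    (hann : ∀ t y, 0 ≤ a t y) (hbnn : ∀ t y, 0 ≤ b t y)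
    (hameas : Measurable (Function.uncurry a)) (hbmeas : Measurable (Function.uncurry b))
    (habdd : ∃ A : ℝ, ∀ t ∈ Set.Icc (0 : ℝ) T, ∀ y : ℝ, a t y ≤ A)
    (hbbdd : ∃ A : ℝ, ∀ t ∈ Set.Icc (0 : ℝ) T, ∀ y : ℝ, b t y ≤ A)
    (hineq : ∀ t ∈ Set.Icc (0 : ℝ) T, ∀ y : ℝ,
      ENNReal.ofReal (a t y) ≤ ENNReal.ofReal (b t y) + ENNReal.ofReal L *
        ∫⁻ s in Set.Ioc (0 : ℝ) t,
          ∫⁻ η : ℝ, ENNReal.ofReal (G (t - s) y η) * ENNReal.ofReal (a s η)) :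
    ∀ t ∈ Set.Icc (0 : ℝ) T, ∀ y : ℝ,
      ENNReal.ofReal (a t y) ≤ ENNReal.ofReal (b t y) +
        ENNReal.ofReal (L * Real.exp (L * t)) *
          ∫⁻ s in Set.Ioc (0 : ℝ) t,
            ∫⁻ η : ℝ, ENNReal.ofReal (G (t - s) y η) * ENNReal.ofReal (b s η) := by
  intro t ht y
  obtain ⟨A, hA⟩ := habdd
  set g : ℝ → ℝ → ℝ → ENNReal := fun t y η => ENNReal.ofReal (G t y η) with hgdef
  have hg : Measurable fun p : ℝ × ℝ × ℝ => g p.1 p.2.1 p.2.2 := hGmeas.ennreal_ofReal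
  have hconv : ∀ {f : ℝ → ℝ → ℝ}, Measurable (Function.uncurry f) →
      Measurable fun p : ℝ × ℝ => g (t - p.1) y p.2 * ENNReal.ofReal (f p.1 p.2) := fun hf =>
    (hg.comp ((measurable_const.sub measurable_fst).prodMk
      (measurable_const.prodMk measurable_snd))).mul hf.ennreal_ofReal
  have hslice : ∀ {f : ℝ → ℝ → ℝ}, Measurable (Function.uncurry f) → ∀ s : ℝ,
      Measurable fun η => g (t - s) y η * ENNReal.ofReal (f s η) := fun hf s =>
    (hconv hf).comp (measurable_const.prodMk measurable_id)
  have hfin : ∫⁻ s in Set.Ioc (0 : ℝ) t,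
      ∫⁻ η : ℝ, g (t - s) y η * ENNReal.ofReal (a s η) ≠ ⊤ := by
    rw [← restrict_Ioo_eq_restrict_Ioc]
    refine ne_top_of_le_ne_top (b := ∫⁻ _ in Set.Ioo (0 : ℝ) t, ENNReal.ofReal A) ?_
      (setLIntegral_mono' measurableSet_Ioo fun s hs => ?_)
    · rw [setLIntegral_const, Real.volume_Ioo]
      exact ENNReal.mul_ne_top ENNReal.ofReal_ne_top ENNReal.ofReal_ne_top
    · calc
        _ ≤ ∫⁻ η : ℝ, g (t - s) y η * ENNReal.ofReal A := by
          gcongr with η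
          exact hA s ⟨hs.1.le, hs.2.le.trans ht.2⟩ η
        _ = (∫⁻ η : ℝ, g (t - s) y η) * ENNReal.ofReal A :=
          lintegral_mul_const' _ _ ENNReal.ofReal_ne_top
        _ ≤ ENNReal.ofReal A :=
          mul_le_of_le_one_left' (hsubMarkov _ (sub_pos.2 hs.2) y)
  have hkey := lintegral_le_exp_mul_of_le_add_mul_lintegral hL
    (m := fun s => ∫⁻ η : ℝ, g (t - s) y η * ENNReal.ofReal (a s η))
    (β := fun s => ∫⁻ η : ℝ, g (t - s) y η * ENNReal.ofReal (b s η))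
    (hconv hameas).lintegral_prod_right' (hconv hbmeas).lintegral_prod_right' hfin
    fun s hs => by
      calc
        _ ≤ ∫⁻ η : ℝ, (g (t - s) y η * ENNReal.ofReal (b s η) + ENNReal.ofReal L *
            (g (t - s) y η * ∫⁻ r in Set.Ioc (0 : ℝ) s,
              ∫⁻ ζ : ℝ, g (s - r) η ζ * ENNReal.ofReal (a r ζ))) := by
          refine lintegral_mono fun η => ?_
          rw [mul_left_comm, ← mul_add]
          gcongr
          exact hineq s ⟨hs.1.le, hs.2.le.trans ht.2⟩ η
        _ = _ := by
          rw [lintegral_add_left (hslice hbmeas s),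
            lintegral_const_mul' _ _ ENNReal.ofReal_ne_top,
            lintegral_kernel_mul_lintegral_kernel hg hCK
              (f := fun r ζ => ENNReal.ofReal (a r ζ)) hameas.ennreal_ofReal hs.2]
  refine (hineq t ht y).trans ?_
  rw [ENNReal.ofReal_mul hL, mul_assoc]
  gcongr
end

section
/- Let (Ω, 𝔄, P) be a probability space, let D ⊆ L¹(ℝ) be a dense linear subspace, and for each g ∈ L¹(ℝ) let X(g) be a real-valued random variable such that X(αg + βh) = α·X(g) + β·X(h) almost surely for all g, h ∈ L¹(ℝ) and α, β ∈ ℝ. Assume there are constants A, B > 0 such that: (i) E|X(g)| ≤ A·‖g‖_{L¹(ℝ)} for every g ∈ L¹(ℝ); and (ii) P(|X(g)| ≥ x) ≤ 2·exp(−x²/(2B²·‖g‖²_{L¹(ℝ)})) for every g ∈ D with ‖g‖_{L¹(ℝ)} > 0 and every x ≥ 0. Then for every g ∈ L¹(ℝ) with ‖g‖_{L¹(ℝ)} > 0 and every x ≥ 0, P(|X(g)| ≥ x) ≤ 2·exp(−x²/(8B²·‖g‖²_{L¹(ℝ)})). -/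
open MeasureTheory

open Filter Topology

/-- Markov's inequality for the tails of a real random variable. -/
lemma measure_le_abs_le_lintegral_div {Ω : Type*} [MeasurableSpace Ω] {P : Measure Ω}
    {Y : Ω → ℝ} (hY : Measurable Y) {y : ℝ} (hy : 0 < y) :
    P {ω | y ≤ |Y ω|} ≤ (∫⁻ ω, ENNReal.ofReal |Y ω| ∂P) / ENNReal.ofReal y := by
  refine le_trans (measure_mono fun ω hω ↦ ?_)
    (meas_ge_le_lintegral_div hY.abs.ennreal_ofReal.aemeasurable
      (ENNReal.ofReal_pos.2 hy).ne' ENNReal.ofReal_ne_top)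
  exact ENNReal.ofReal_le_ofReal hω

/-- If `Y = Z - W` almost surely, the tail of `Y` at `x` is controlled by the tails of `Z` and `W`
at `x / 2`. -/
lemma measure_le_abs_le_add_of_ae_eq_sub {Ω : Type*} [MeasurableSpace Ω] {P : Measure Ω}
    {Y Z W : Ω → ℝ} (h : ∀ᵐ ω ∂P, W ω = Z ω - Y ω) (x : ℝ) :
    P {ω | x ≤ |Y ω|} ≤ P {ω | x / 2 ≤ |Z ω|} + P {ω | x / 2 ≤ |W ω|} := by
  refine le_trans (measure_mono_ae ?_) (measure_union_le _ _)
  filter_upwards [h] with ω hω (hx : x ≤ |Y ω|)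
  change x / 2 ≤ |Z ω| ∨ x / 2 ≤ |W ω|
  by_contra! hlt
  have hY : Y ω = Z ω - W ω := by rw [hω]; ring
  have := abs_sub (Z ω) (W ω)
  rw [hY] at hx
  linarith

/-- **Extension of a sub-Gaussian concentration inequality from a dense subspace of `L¹(ℝ)`**
(Step 3 of the proof of Theorem 2.2(a) of the paper): let `X(g)` be an a.s.-linear family of
random variables indexed by `g ∈ L¹(ℝ)` with `E|X(g)| ≤ A‖g‖₁` for all `g`, and suppose that
`P(|X(g)| ≥ x) ≤ 2 exp (−x²/(2B²‖g‖₁²))` for all `g` in a dense linear subspace `D` with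
`‖g‖₁ > 0` and all `x ≥ 0`. Then for every `g ∈ L¹(ℝ)` with `‖g‖₁ > 0` and every `x ≥ 0`,
`P(|X(g)| ≥ x) ≤ 2 exp (−x²/(8B²‖g‖₁²))`. -/
theorem subgaussian_extension_from_dense_subspace
    {Ω : Type*} [MeasurableSpace Ω] (P : Measure Ω) [IsProbabilityMeasure P]
    (D : Submodule ℝ (Lp ℝ 1 (volume : Measure ℝ)))
    (hD : Dense (D : Set (Lp ℝ 1 (volume : Measure ℝ))))
    (X : Lp ℝ 1 (volume : Measure ℝ) → Ω → ℝ)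
    (hXmeas : ∀ g, Measurable (X g))
    (hlin : ∀ (g h : Lp ℝ 1 (volume : Measure ℝ)) (α β : ℝ),
      ∀ᵐ ω ∂P, X (α • g + β • h) ω = α * X g ω + β * X h ω)
    (A B : ℝ) (hA : 0 < A) (hB : 0 < B)
    (hmoment : ∀ g, ∫⁻ ω, ENNReal.ofReal |X g ω| ∂P ≤ ENNReal.ofReal (A * ‖g‖))
    (hsub : ∀ g ∈ D, 0 < ‖g‖ → ∀ x : ℝ, 0 ≤ x →
      P {ω : Ω | x ≤ |X g ω|} ≤
        ENNReal.ofReal (2 * Real.exp (-x ^ 2 / (2 * B ^ 2 * ‖g‖ ^ 2)))) :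
    ∀ g : Lp ℝ 1 (volume : Measure ℝ), 0 < ‖g‖ → ∀ x : ℝ, 0 ≤ x →
      P {ω : Ω | x ≤ |X g ω|} ≤
        ENNReal.ofReal (2 * Real.exp (-x ^ 2 / (8 * B ^ 2 * ‖g‖ ^ 2))) := by
  intro g hg x hx
  rcases hx.eq_or_lt with rfl | hx
  · refine prob_le_one.trans ?_
    norm_num
  have hx2 : 0 < x / 2 := half_pos hx
  let F : Lp ℝ 1 (volume : Measure ℝ) → ENNReal := fun h ↦
    ENNReal.ofReal (2 * Real.exp (-(x / 2) ^ 2 / (2 * B ^ 2 * ‖h‖ ^ 2))) +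
      ENNReal.ofReal (A * ‖h - g‖) / ENNReal.ofReal (x / 2)
  have hF : Tendsto F (𝓝 g)
      (𝓝 (ENNReal.ofReal (2 * Real.exp (-x ^ 2 / (8 * B ^ 2 * ‖g‖ ^ 2))))) := by
    have h₁ : ContinuousAt (fun h : Lp ℝ 1 (volume : Measure ℝ) ↦
        2 * Real.exp (-(x / 2) ^ 2 / (2 * B ^ 2 * ‖h‖ ^ 2))) g := by
      have : 2 * B ^ 2 * ‖g‖ ^ 2 ≠ 0 := by positivity
      fun_prop (disch := assumption)
    have h₂ : Tendsto (fun h : Lp ℝ 1 (volume : Measure ℝ) ↦ A * ‖h - g‖) (𝓝 g) (𝓝 0) :=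
      Continuous.tendsto' (by fun_prop) _ _ (by simp)
    convert (ENNReal.tendsto_ofReal h₁.tendsto).add
      (ENNReal.Tendsto.div_const (ENNReal.tendsto_ofReal h₂)
        (Or.inr (ENNReal.ofReal_pos.2 hx2).ne')) using 2
    rw [ENNReal.ofReal_zero, ENNReal.zero_div, add_zero]
    congr 3
    field_simp
    norm_num
  have : (𝓝[(D : Set (Lp ℝ 1 (volume : Measure ℝ)))] g).NeBot :=
    mem_closure_iff_nhdsWithin_neBot.1 (hD g)
  refine ge_of_tendsto (hF.mono_left (nhdsWithin_le_nhds (s := D))) ?_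
  filter_upwards [self_mem_nhdsWithin,
    nhdsWithin_le_nhds (continuous_norm.continuousAt.eventually (lt_mem_nhds hg))] with h hh hpos
  have hdiff : ∀ᵐ ω ∂P, X (h - g) ω = X h ω - X g ω := by
    simpa [← sub_eq_add_neg] using hlin h g 1 (-1)
  calc P {ω | x ≤ |X g ω|}
      ≤ P {ω | x / 2 ≤ |X h ω|} + P {ω | x / 2 ≤ |X (h - g) ω|} :=
        measure_le_abs_le_add_of_ae_eq_sub hdiff x
    _ ≤ F h := add_le_add (hsub h hh hpos _ hx2.le)
        ((measure_le_abs_le_lintegral_div (hXmeas _) hx2).trans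
          (ENNReal.div_le_div_right (hmoment _) _))
end
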